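/- Let λ > 0, r > 0, d > 0, let β : ℝ → ℝ be bounded and continuous, let l̄ ∈ ℝ, and set j(z) = z + ln(d/(λ+d)). Define V_B : (−∞, l̄] → ℝ by V_B(l) = exp(−(r+λ+d)(l̄−l)/λ)·β(l̄)/r + ∫_l^{l̄} [ β(z)/λ + (λ+d)·β(j(z))/(rλ) ] · exp(−(r+λ+d)(z−l)/λ) dz. Then V_B is continuous on (−∞, l̄] with V_B(l̄) = β(l̄)/r, V_B is differentiable on (−∞, l̄), and for every l < l̄ it satisfies r·V_B(l) = β(l) + λ·V_B′(l) + (λ+d)·( β(j(l))/r − V_B(l) ). -/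

import Mathlib

open MeasureTheory

/-- The discounted integral of a continuous flow `f` up to the endpoint `b`, with terminal
payoff `c`, solves the linear differential equation `V' = k V - f`. -/
theorem hasDerivAt_discounted_integral {f : ℝ → ℝ} (hf : Continuous f) (k c b l : ℝ) :
    HasDerivAt
      (fun x ↦ Real.exp (-(k * (b - x))) * c + ∫ z in x..b, f z * Real.exp (-(k * (z - x))))
      (k * (Real.exp (-(k * (b - l))) * c + ∫ z in l..b, f z * Real.exp (-(k * (z - l)))) - f l)
      l := by
  have hfactor : ∀ x, Real.exp (-(k * (b - x))) * c + ∫ z in x..b, f z * Real.exp (-(k * (z - x)))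
      = Real.exp (k * x) * (Real.exp (-(k * b)) * c + ∫ z in x..b, f z * Real.exp (-(k * z))) := by
    intro x
    have hsplit : ∀ z, Real.exp (-(k * (z - x))) = Real.exp (k * x) * Real.exp (-(k * z)) := by
      intro z
      rw [← Real.exp_add]
      congr 1
      ring
    simp_rw [hsplit, mul_left_comm (f _) (Real.exp (k * x))]
    rw [intervalIntegral.integral_const_mul]
    ring
  have hg : Continuous fun z ↦ f z * Real.exp (-(k * z)) := by fun_prop
  have hint : HasDerivAt (fun x ↦ ∫ z in x..b, f z * Real.exp (-(k * z)))
      (-(f l * Real.exp (-(k * l)))) l :=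
    intervalIntegral.integral_hasDerivAt_left (hg.intervalIntegrable l b)
      (hg.stronglyMeasurableAtFilter _ _) hg.continuousAt
  have hexp : HasDerivAt (fun x ↦ Real.exp (k * x)) (Real.exp (k * l) * (k * 1)) l :=
    ((hasDerivAt_id l).const_mul k).exp
  simp_rw [hfactor]
  refine (hexp.mul (hint.const_add (Real.exp (-(k * b)) * c))).congr_deriv ?_
  have hinv : Real.exp (k * l) * Real.exp (-(k * l)) = 1 := by
    rw [← Real.exp_add, add_neg_cancel, Real.exp_zero]
  linear_combination (-f l) * hinv

/-- Closed-form solution (8) of the bad type's HJB equation in the scrutiny region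
with minimal signal rate `d > 0` and finite upper endpoint `l̄`: the function `V_B`
defined by the explicit formula is continuous on `(-∞, l̄]`, satisfies the
value-matching condition `V_B(l̄) = β(l̄)/r`, is differentiable on `(-∞, l̄)`, and
solves `r V_B(l) = β(l) + λ V_B'(l) + (λ+d) (β(j(l))/r - V_B(l))` there. -/
theorem stmt_2
    (lam r d lb : ℝ) (hlam : 0 < lam) (hr : 0 < r) (hd : 0 < d)
    (β : ℝ → ℝ) (hβb : ∃ M, ∀ x, |β x| ≤ M) (hβc : Continuous β)
    (j : ℝ → ℝ) (hj : ∀ z, j z = z + Real.log (d / (lam + d)))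
    (VB : ℝ → ℝ)
    (hVB : ∀ l, VB l =
      Real.exp (-((r + lam + d) * (lb - l) / lam)) * (β lb / r) +
      ∫ z in l..lb, (β z / lam + (lam + d) * β (j z) / (r * lam)) *
        Real.exp (-((r + lam + d) * (z - l) / lam))) :
    ContinuousOn VB (Set.Iic lb) ∧
    VB lb = β lb / r ∧
    (∀ l < lb, DifferentiableAt ℝ VB l) ∧
    (∀ l < lb,
      r * VB l = β l + lam * deriv VB l + (lam + d) * (β (j l) / r - VB l)) := by
  have hjc : Continuous j := by
    rw [funext hj]
    fun_prop
  have hf : Continuous fun z ↦ β z / lam + (lam + d) * β (j z) / (r * lam) := by fun_prop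
  have hder : ∀ l, HasDerivAt VB ((r + lam + d) / lam * VB l -
      (β l / lam + (lam + d) * β (j l) / (r * lam))) l := by
    intro l
    have h := hasDerivAt_discounted_integral hf ((r + lam + d) / lam) (β lb / r) lb l
    simp_rw [div_mul_eq_mul_div, ← hVB] at h
    rw [div_mul_eq_mul_div]
    exact h
  refine ⟨fun l _ ↦ (hder l).continuousAt.continuousWithinAt, ?_,
    fun l _ ↦ (hder l).differentiableAt, fun l _ ↦ ?_⟩
  · simp [hVB]
  · rw [(hder l).deriv]
    field_simp
    ring
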